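/- For every subspace S of W and every code-definition vector q with q(v) ≥ 0 for all v and Σ_{v∈W} q(v) = 1, the Möbius expansion ψ(S) := Σ_{T} (−1)^{dim S − dim T} · 2^{(dim S − dim T)(dim S − dim T − 1)/2} · ε^{n(1 − ζ(T,q))}, the sum ranging over all subspaces T of S, is nonnegative: ψ(S) ≥ 0. -/

import Mathlib

attribute [local instance] Classical.propDecidable

noncomputable instance {κ : ℕ} : Fintype (Submodule (ZMod 2) (Fin κ → ZMod 2)) :=
  haveI : Finite (Submodule (ZMod 2) (Fin κ → ZMod 2)) :=
    Finite.of_injective (fun S => (S : Set (Fin κ → ZMod 2))) SetLike.coe_injective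
  Fintype.ofFinite _

/-- `ζ(S,q)`: the sum of `q v` over the vectors `v` lying in the subspace `S`. -/
noncomputable def zeta (κ : ℕ) (S : Submodule (ZMod 2) (Fin κ → ZMod 2))
    (q : (Fin κ → ZMod 2) → ℝ) : ℝ :=
  ∑ v : Fin κ → ZMod 2, if v ∈ S then q v else 0

/-- The Möbius coefficient `(-1)^d 2^(d(d-1)/2)` of the subspace lattice over the two-element
field. -/
noncomputable def moebiusCoeff (d : ℕ) : ℝ := (-1) ^ d * 2 ^ (d * (d - 1) / 2)

theorem moebiusCoeff_succ (d : ℕ) : moebiusCoeff (d + 1) = -(2 ^ d * moebiusCoeff d) := by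
  have h : (d + 1) * (d + 1 - 1) / 2 = d + d * (d - 1) / 2 := by
    rw [← Nat.choose_two_right, ← Nat.choose_two_right, Nat.choose_succ_succ' d 1,
      Nat.choose_one_right]
  rw [moebiusCoeff, moebiusCoeff, h, pow_succ, pow_add]
  ring

section Hyperplane

variable {V : Type*} [AddCommGroup V] [Module (ZMod 2) V]

theorem zmod_two_eq_one_of_ne_zero {a : ZMod 2} (h : a ≠ 0) : a = 1 := by
  revert a
  decide

theorem inf_ker_sup_span_singleton (φ : V →ₗ[ZMod 2] ZMod 2) {x : V} (hx : φ x = 1)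
    {T : Submodule (ZMod 2) V} (hT : x ∈ T) :
    (T ⊓ LinearMap.ker φ) ⊔ Submodule.span (ZMod 2) {x} = T := by
  apply le_antisymm
  · exact sup_le inf_le_left ((Submodule.span_singleton_le_iff_mem _ _).2 hT)
  · intro y hy
    have h : y - φ y • x ∈ T ⊓ LinearMap.ker φ :=
      ⟨T.sub_mem hy (T.smul_mem _ hT), by simp [hx]⟩
    have h' := Submodule.add_mem_sup h
      (Submodule.smul_mem _ (φ y) (Submodule.mem_span_singleton_self (R := ZMod 2) x))
    simpa using h'

theorem sup_span_singleton_inf_ker (φ : V →ₗ[ZMod 2] ZMod 2) {x : V} (hx : φ x = 1)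
    {T : Submodule (ZMod 2) V} (hT : T ≤ LinearMap.ker φ) :
    (T ⊔ Submodule.span (ZMod 2) {x}) ⊓ LinearMap.ker φ = T := by
  apply le_antisymm
  · rintro y ⟨hy, hy'⟩
    obtain ⟨t, ht, z, hz, rfl⟩ := Submodule.mem_sup.1 hy
    obtain ⟨a, rfl⟩ := Submodule.mem_span_singleton.1 hz
    have h1 : φ t = 0 := hT ht
    have h2 : φ (t + a • x) = 0 := hy'
    have ha : a = 0 := by simpa [h1, hx] using h2
    simpa [ha] using ht
  · exact le_inf le_sup_left hT

theorem finrank_inf_ker_add_one [FiniteDimensional (ZMod 2) V] (φ : V →ₗ[ZMod 2] ZMod 2)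
    {x : V} (hx : φ x = 1) {T : Submodule (ZMod 2) V} (hT : x ∈ T) :
    Module.finrank (ZMod 2) ↥(T ⊓ LinearMap.ker φ) + 1 = Module.finrank (ZMod 2) T := by
  have hx0 : x ≠ 0 := by
    rintro rfl
    simp at hx
  have hinf : (T ⊓ LinearMap.ker φ) ⊓ Submodule.span (ZMod 2) {x} = ⊥ := by
    rw [eq_bot_iff]
    rintro y ⟨⟨-, hy⟩, hz⟩
    obtain ⟨a, rfl⟩ := Submodule.mem_span_singleton.1 hz
    have h : φ (a • x) = 0 := hy
    have ha : a = 0 := by simpa [hx] using h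
    simp [ha]
  have h := Submodule.finrank_sup_add_finrank_inf_eq (T ⊓ LinearMap.ker φ)
    (Submodule.span (ZMod 2) {x})
  rw [inf_ker_sup_span_singleton φ hx hT, hinf, finrank_bot, finrank_span_singleton hx0] at h
  omega

theorem card_filter_apply_eq_one [Fintype V] (φ : V →ₗ[ZMod 2] ZMod 2)
    {x : V} (hx : φ x = 1) {T : Submodule (ZMod 2) V} (hT : x ∈ T) :
    (Finset.univ.filter fun y : V => y ∈ T ∧ φ y = 1).card =
      2 ^ Module.finrank (ZMod 2) ↥(T ⊓ LinearMap.ker φ) := by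
  have h := Module.card_eq_pow_finrank (K := ZMod 2) (V := ↥(T ⊓ LinearMap.ker φ))
  rw [ZMod.card] at h
  rw [← h, Fintype.card_subtype]
  refine Finset.card_bij' (fun y _ => y - x) (fun y _ => y + x) ?_ ?_ ?_ ?_
  · intro y hy
    simp only [Finset.mem_filter, Finset.mem_univ, true_and] at hy ⊢
    exact ⟨T.sub_mem hy.1 hT, by simp [hy.2, hx]⟩
  · intro y hy
    simp only [Finset.mem_filter, Finset.mem_univ, true_and] at hy ⊢
    have h0 : φ y = 0 := hy.2
    exact ⟨T.add_mem hy.1 hT, by simp [h0, hx]⟩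
  · simp
  · simp

theorem sum_moebiusCoeff_eq_zero [Fintype V] [Fintype (Submodule (ZMod 2) V)]
    {U S : Submodule (ZMod 2) V} (hUS : U < S) :
    ∑ T ∈ Finset.univ.filter (fun T : Submodule (ZMod 2) V => U ≤ T ∧ T ≤ S),
      moebiusCoeff (Module.finrank (ZMod 2) S - Module.finrank (ZMod 2) T) = 0 := by
  obtain ⟨x₀, hx₀S, hx₀U⟩ := SetLike.exists_of_lt hUS
  obtain ⟨φ, hφ, hUφ⟩ := Submodule.exists_le_ker_of_notMem hx₀U
  have hφ₀ : φ x₀ = 1 := zmod_two_eq_one_of_ne_zero hφ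
  set K := LinearMap.ker φ with hK
  set I := Finset.univ.filter (fun T : Submodule (ZMod 2) V => U ≤ T ∧ T ≤ S) with hI
  set D := Finset.univ.filter (fun y : V => y ∈ S ∧ φ y = 1) with hD
  have hDcard := card_filter_apply_eq_one φ hφ₀ hx₀S
  have hS := finrank_inf_ker_add_one φ hφ₀ hx₀S
  rw [← hK] at hDcard hS
  set m := Module.finrank (ZMod 2) ↥(S ⊓ K) with hm
  have hle : ∀ T : Submodule (ZMod 2) V, T ≤ S → T ≤ K → Module.finrank (ZMod 2) T ≤ m :=
    fun T h1 h2 => Submodule.finrank_mono (le_inf h1 h2)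
  have hfiber : ∀ x ∈ D,
      ∑ T ∈ (I.filter fun T => ¬ T ≤ K).filter (fun T => x ∈ T),
        moebiusCoeff (Module.finrank (ZMod 2) S - Module.finrank (ZMod 2) T) /
          2 ^ Module.finrank (ZMod 2) ↥(T ⊓ K) =
      ∑ T ∈ I.filter fun T => T ≤ K,
        moebiusCoeff (m - Module.finrank (ZMod 2) T) / 2 ^ Module.finrank (ZMod 2) T := by
    intro x hx
    simp only [hD, Finset.mem_filter, Finset.mem_univ, true_and] at hx
    refine Finset.sum_bij' (fun T _ => T ⊓ K) (fun T _ => T ⊔ Submodule.span (ZMod 2) {x})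
      ?_ ?_ ?_ ?_ ?_
    · intro T hT
      simp only [hI, Finset.mem_filter, Finset.mem_univ, true_and] at hT ⊢
      exact ⟨⟨le_inf hT.1.1.1 hUφ, inf_le_left.trans hT.1.1.2⟩, inf_le_right⟩
    · intro T hT
      simp only [hI, Finset.mem_filter, Finset.mem_univ, true_and] at hT ⊢
      have hxT : x ∈ T ⊔ Submodule.span (ZMod 2) {x} :=
        le_sup_right (a := T) (Submodule.mem_span_singleton_self x)
      refine ⟨⟨⟨hT.1.1.trans le_sup_left,
        sup_le hT.1.2 ((Submodule.span_singleton_le_iff_mem _ _).2 hx.1)⟩, fun h => ?_⟩, hxT⟩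
      have h0 : φ x = 0 := h hxT
      rw [hx.2] at h0
      exact one_ne_zero h0
    · intro T hT
      exact inf_ker_sup_span_singleton φ hx.2 (Finset.mem_filter.1 hT).2
    · intro T hT
      exact sup_span_singleton_inf_ker φ hx.2 (Finset.mem_filter.1 hT).2
    · intro T hT
      have h := finrank_inf_ker_add_one φ hx.2 (Finset.mem_filter.1 hT).2
      rw [← h, ← hS, Nat.add_sub_add_right]
  have hnot : ∑ T ∈ I.filter (fun T => ¬ T ≤ K),
      moebiusCoeff (Module.finrank (ZMod 2) S - Module.finrank (ZMod 2) T) =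
      ∑ T ∈ I.filter fun T => T ≤ K, 2 ^ (m - Module.finrank (ZMod 2) T) *
        moebiusCoeff (m - Module.finrank (ZMod 2) T) := by
    calc
      _ = ∑ T ∈ I.filter (fun T => ¬ T ≤ K), ∑ x ∈ D.filter (fun x => x ∈ T),
          moebiusCoeff (Module.finrank (ZMod 2) S - Module.finrank (ZMod 2) T) /
            2 ^ Module.finrank (ZMod 2) ↥(T ⊓ K) := by
        refine Finset.sum_congr rfl fun T hT => ?_
        simp only [hI, Finset.mem_filter, Finset.mem_univ, true_and] at hT
        obtain ⟨y, hyT, hyK⟩ := SetLike.not_le_iff_exists.1 hT.2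
        have hc := card_filter_apply_eq_one φ (zmod_two_eq_one_of_ne_zero hyK) hyT
        have hDT : D.filter (fun x => x ∈ T) =
            Finset.univ.filter fun y : V => y ∈ T ∧ φ y = 1 := by
          ext z
          simp only [hD, Finset.mem_filter, Finset.mem_univ, true_and]
          exact ⟨fun h => ⟨h.2, h.1.2⟩, fun h => ⟨⟨hT.1.2 h.1, h.2⟩, h.1⟩⟩
        rw [Finset.sum_const, hDT, hc, nsmul_eq_mul, ← hK]
        push_cast
        field_simp
      _ = ∑ x ∈ D, ∑ T ∈ (I.filter fun T => ¬ T ≤ K).filter (fun T => x ∈ T),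
          moebiusCoeff (Module.finrank (ZMod 2) S - Module.finrank (ZMod 2) T) /
            2 ^ Module.finrank (ZMod 2) ↥(T ⊓ K) := by
        refine Finset.sum_comm' fun T x => ?_
        simp only [Finset.mem_filter]
        tauto
      _ = _ := by
        rw [Finset.sum_congr rfl hfiber, Finset.sum_const, hDcard, nsmul_eq_mul, Finset.mul_sum]
        refine Finset.sum_congr rfl fun T hT => ?_
        simp only [hI, Finset.mem_filter, Finset.mem_univ, true_and] at hT
        rw [pow_sub₀ _ two_ne_zero (hle T hT.1.2 hT.2)]
        push_cast
        field_simp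
  rw [← Finset.sum_filter_add_sum_filter_not I (fun T => T ≤ K), hnot,
    ← Finset.sum_add_distrib]
  refine Finset.sum_eq_zero fun T hT => ?_
  simp only [hI, Finset.mem_filter, Finset.mem_univ, true_and] at hT
  rw [← hS, Nat.sub_add_comm (hle T hT.1.2 hT.2), moebiusCoeff_succ]
  ring

theorem sum_moebiusCoeff_nonneg [Fintype V] [Fintype (Submodule (ZMod 2) V)]
    (U S : Submodule (ZMod 2) V) :
    0 ≤ ∑ T ∈ Finset.univ.filter (fun T : Submodule (ZMod 2) V => U ≤ T ∧ T ≤ S),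
      moebiusCoeff (Module.finrank (ZMod 2) S - Module.finrank (ZMod 2) T) := by
  by_cases hUS : U ≤ S
  · rcases hUS.lt_or_eq with h | rfl
    · exact (sum_moebiusCoeff_eq_zero h).ge
    · refine Finset.sum_nonneg fun T hT => ?_
      obtain ⟨h1, h2⟩ := (Finset.mem_filter.1 hT).2
      rw [le_antisymm h2 h1]
      simp [moebiusCoeff]
  · refine Finset.sum_nonneg fun T hT => ?_
    obtain ⟨h1, h2⟩ := (Finset.mem_filter.1 hT).2
    exact absurd (h1.trans h2) hUS

end Hyperplane

theorem rpow_sum_of_nonneg {ι : Type*} {a : ℝ} (ha : 0 ≤ a) (s : Finset ι) {f : ι → ℝ}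
    (hf : ∀ i ∈ s, 0 ≤ f i) : a ^ (∑ i ∈ s, f i) = ∏ i ∈ s, a ^ f i := by
  induction s using Finset.cons_induction with
  | empty => simp
  | cons i s hi ih =>
    rw [Finset.sum_cons, Finset.prod_cons, Real.rpow_add_of_nonneg ha (hf i (by simp))
      (Finset.sum_nonneg fun j hj => hf j (by simp [hj])), ih fun j hj => hf j (by simp [hj])]

theorem rpow_one_sub_zeta (κ n : ℕ) {ε : ℝ} (hε : 0 ≤ ε) {q : (Fin κ → ZMod 2) → ℝ}
    (hq0 : ∀ v, 0 ≤ q v) (hq1 : ∑ v, q v = 1) (T : Submodule (ZMod 2) (Fin κ → ZMod 2)) :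
    ε ^ ((n : ℝ) * (1 - zeta κ T q)) =
      ∑ A : Finset (Fin κ → ZMod 2), if Submodule.span (ZMod 2) (A : Set (Fin κ → ZMod 2)) ≤ T
        then (∏ v ∈ A, (1 - ε ^ ((n : ℝ) * q v))) *
          ∏ v ∈ Finset.univ \ A, ε ^ ((n : ℝ) * q v) else 0 := by
  have h1 : (n : ℝ) * (1 - zeta κ T q) = ∑ v, if v ∈ T then 0 else (n : ℝ) * q v := by
    rw [← hq1, zeta, ← Finset.sum_sub_distrib, Finset.mul_sum]
    refine Finset.sum_congr rfl fun v _ => ?_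
    split_ifs <;> simp
  have h2 : ∀ v ∈ Finset.univ, 0 ≤ if v ∈ T then 0 else (n : ℝ) * q v := by
    intro v _
    have := hq0 v
    split_ifs <;> positivity
  have h3 : ∀ v, ε ^ (if v ∈ T then 0 else (n : ℝ) * q v) =
      (if v ∈ T then 1 - ε ^ ((n : ℝ) * q v) else 0) + ε ^ ((n : ℝ) * q v) := by
    intro v
    split_ifs <;> simp
  rw [h1, rpow_sum_of_nonneg hε _ h2, Finset.prod_congr rfl fun v _ => h3 v, Finset.prod_add,
    Finset.powerset_univ]
  refine Finset.sum_congr rfl fun A _ => ?_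
  rw [Finset.prod_ite_zero, ite_mul, zero_mul]
  simp only [Submodule.span_le, Set.subset_def, SetLike.mem_coe]
  congr

/-- Lemma 1: nonnegativity of the Möbius expansion `ψ(S)`. -/
theorem psi_nonneg (κ n : ℕ) (hκ : 1 ≤ κ) (hn : 1 ≤ n) (ε : ℝ) (hε0 : 0 ≤ ε) (hε1 : ε < 1)
    (q : (Fin κ → ZMod 2) → ℝ) (hq0 : ∀ v, 0 ≤ q v) (hq1 : ∑ v, q v = 1)
    (S : Submodule (ZMod 2) (Fin κ → ZMod 2)) :
    0 ≤ ∑ T ∈ Finset.univ.filter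
          (fun T : Submodule (ZMod 2) (Fin κ → ZMod 2) => T ≤ S),
        (-1 : ℝ) ^ (Module.finrank (ZMod 2) S - Module.finrank (ZMod 2) T) *
          (2 : ℝ) ^ ((Module.finrank (ZMod 2) S - Module.finrank (ZMod 2) T) *
              (Module.finrank (ZMod 2) S - Module.finrank (ZMod 2) T - 1) / 2) *
          ε ^ ((n : ℝ) * (1 - zeta κ T q)) := by
  change 0 ≤ ∑ T ∈ Finset.univ.filter
    (fun T : Submodule (ZMod 2) (Fin κ → ZMod 2) => T ≤ S),
      moebiusCoeff (Module.finrank (ZMod 2) S - Module.finrank (ZMod 2) T) *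
        ε ^ ((n : ℝ) * (1 - zeta κ T q))
  simp only [rpow_one_sub_zeta κ n hε0 hq0 hq1, Finset.mul_sum]
  rw [Finset.sum_comm]
  refine Finset.sum_nonneg fun A _ => ?_
  simp only [mul_ite, mul_zero]
  rw [← Finset.sum_filter, Finset.filter_filter, ← Finset.sum_mul]
  simp only [and_comm (a := _ ≤ S)]
  refine mul_nonneg (sum_moebiusCoeff_nonneg _ S) (mul_nonneg ?_ ?_)
  · refine Finset.prod_nonneg fun v _ => sub_nonneg.2 ?_
    exact Real.rpow_le_one hε0 hε1.le (mul_nonneg n.cast_nonneg (hq0 v))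
  · exact Finset.prod_nonneg fun v _ => Real.rpow_nonneg hε0 _
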